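/- Let X be a geodesic δ-hyperbolic metric space (δ ≥ 0) and S ⊆ Isom(X) a finite symmetric set of isometries (S = S⁻¹). Then ℓ(S) ≤ L(S²)/2 ≤ ℓ(S) + 2δ. -/

import Mathlib

open Pointwise Filter

/-- The joint displacement of a set of isometries at a point:
`L(S,x) = max_{s ∈ S} d(x, s x)`. -/
noncomputable def jointDispAt {X : Type*} [MetricSpace X] (S : Set (X ≃ᵢ X)) (x : X) : ℝ :=
  sSup ((fun s : X ≃ᵢ X => dist x (s x)) '' S)

/-- The joint minimal displacement `L(S) = inf_x L(S,x)`. -/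
noncomputable def jointMinDisp {X : Type*} [MetricSpace X] (S : Set (X ≃ᵢ X)) : ℝ :=
  sInf (Set.range (jointDispAt S))

/-- The asymptotic joint displacement `ℓ(S) = lim_n L(S^n)/n`; the limit exists by
subadditivity, hence agrees with the `limsup` used here. -/
noncomputable def asympDisp {X : Type*} [MetricSpace X] (S : Set (X ≃ᵢ X)) : ℝ :=
  Filter.limsup (fun n : ℕ => jointMinDisp (S ^ n) / n) Filter.atTop

/-- `λ(S) = max_{s ∈ S} ℓ(s)`. -/
noncomputable def lamD {X : Type*} [MetricSpace X] (S : Set (X ≃ᵢ X)) : ℝ :=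
  sSup ((fun s : X ≃ᵢ X => asympDisp {s}) '' S)

/-- `λ_k(S) = max_{1 ≤ j ≤ k} λ(S^j)/j`. -/
noncomputable def lamK {X : Type*} [MetricSpace X] (k : ℕ) (S : Set (X ≃ᵢ X)) : ℝ :=
  sSup ((fun j : ℕ => lamD (S ^ j) / j) '' Set.Icc 1 k)

/-- `λ_∞(S) = sup_{j ≥ 1} λ(S^j)/j`. -/
noncomputable def lamInf {X : Type*} [MetricSpace X] (S : Set (X ≃ᵢ X)) : ℝ :=
  sSup ((fun j : ℕ => lamD (S ^ j) / j) '' Set.Ici 1)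

/-- A geodesic segment from `a` to `b`: an isometric image of the interval `[0, d(a,b)]`. -/
def IsGeodesicSegment {X : Type*} [MetricSpace X] (s : Set X) (a b : X) : Prop :=
  ∃ f : ℝ → X, f 0 = a ∧ f (dist a b) = b ∧
    (∀ u ∈ Set.Icc (0 : ℝ) (dist a b), ∀ v ∈ Set.Icc (0 : ℝ) (dist a b),
      dist (f u) (f v) = |u - v|) ∧
    s = f '' Set.Icc (0 : ℝ) (dist a b)

/-- A geodesic metric space: every two points are joined by a geodesic segment. -/
def GeodesicSpace (X : Type*) [MetricSpace X] : Prop :=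
  ∀ a b : X, ∃ s : Set X, IsGeodesicSegment s a b

/-- `δ`-hyperbolicity: every geodesic triangle is `δ`-thin, i.e. each side is contained in
the closed `δ`-neighborhood of the union of the other two sides. -/
def GromovHyperbolic (X : Type*) [MetricSpace X] (δ : ℝ) : Prop :=
  ∀ a b c : X, ∀ sab sbc sca : Set X,
    IsGeodesicSegment sab a b → IsGeodesicSegment sbc b c → IsGeodesicSegment sca c a →
      (∀ x ∈ sab, ∃ y ∈ sbc ∪ sca, dist x y ≤ δ) ∧
      (∀ x ∈ sbc, ∃ y ∈ sab ∪ sca, dist x y ≤ δ) ∧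
      (∀ x ∈ sca, ∃ y ∈ sab ∪ sbc, dist x y ≤ δ)

/-- The CAT(0) comparison inequality: for all `a b c` and every midpoint `m` of a geodesic
from `b` to `c`, `2 d(a,m)² ≤ d(a,b)² + d(a,c)² - d(b,c)²/2`. -/
def CAT0 (X : Type*) [MetricSpace X] : Prop :=
  ∀ a b c m : X, dist b m = dist b c / 2 → dist m c = dist b c / 2 →
    2 * dist a m ^ 2 ≤ dist a b ^ 2 + dist a c ^ 2 - dist b c ^ 2 / 2

/-- A subset is (geodesically) convex if every geodesic segment between two of its points is
contained in it. -/
def GeodConvex {X : Type*} [MetricSpace X] (C : Set X) : Prop :=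
  ∀ a ∈ C, ∀ b ∈ C, ∀ s : Set X, IsGeodesicSegment s a b → s ⊆ C

/-- Translation length `L(g) = inf_x d(x, g x)`. -/
noncomputable def transLen {X : Type*} [MetricSpace X] (g : X ≃ᵢ X) : ℝ :=
  sInf (Set.range fun x : X => dist x (g x))

/-- Asymptotic translation length `ℓ(g) = lim_n L(g^n)/n`. -/
noncomputable def asympTransLen {X : Type*} [MetricSpace X] (g : X ≃ᵢ X) : ℝ :=
  Filter.limsup (fun n : ℕ => transLen (g ^ n) / n) Filter.atTop

section JointDisplacement

variable {X : Type*} [MetricSpace X]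

lemma finite_pow {M : Type*} [Monoid M] {S : Set M} (hfin : S.Finite) (n : ℕ) :
    (S ^ n).Finite := by
  induction n with
  | zero => simp
  | succ n ih => rw [pow_succ]; exact ih.mul hfin

lemma dist_le_jointDispAt {S : Set (X ≃ᵢ X)} (hfin : S.Finite) (x : X) {s : X ≃ᵢ X}
    (hs : s ∈ S) : dist x (s x) ≤ jointDispAt S x :=
  le_csSup (hfin.image _).bddAbove (Set.mem_image_of_mem _ hs)

lemma jointDispAt_le {S : Set (X ≃ᵢ X)} (hne : S.Nonempty) {x : X} {M : ℝ}
    (h : ∀ s ∈ S, dist x (s x) ≤ M) : jointDispAt S x ≤ M :=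
  csSup_le (hne.image _) (by rintro _ ⟨s, hs, rfl⟩; exact h s hs)

lemma exists_dist_eq_jointDispAt {S : Set (X ≃ᵢ X)} (hfin : S.Finite) (hne : S.Nonempty)
    (x : X) : ∃ s ∈ S, dist x (s x) = jointDispAt S x :=
  (hne.image _).csSup_mem (hfin.image fun s : X ≃ᵢ X => dist x (s x))

lemma jointDispAt_nonneg (S : Set (X ≃ᵢ X)) (x : X) : 0 ≤ jointDispAt S x :=
  Real.sSup_nonneg (by rintro _ ⟨s, -, rfl⟩; exact dist_nonneg)

lemma jointMinDisp_nonneg (S : Set (X ≃ᵢ X)) : 0 ≤ jointMinDisp S :=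
  Real.sInf_nonneg (by rintro _ ⟨x, rfl⟩; exact jointDispAt_nonneg S x)

lemma jointMinDisp_le_jointDispAt (S : Set (X ≃ᵢ X)) (x : X) :
    jointMinDisp S ≤ jointDispAt S x :=
  csInf_le ⟨0, by rintro _ ⟨y, rfl⟩; exact jointDispAt_nonneg S y⟩ ⟨x, rfl⟩

lemma jointMinDisp_of_isEmpty [IsEmpty X] (S : Set (X ≃ᵢ X)) : jointMinDisp S = 0 := by
  simp [jointMinDisp, Set.range_eq_empty]

lemma dist_mul_apply_le (g h : X ≃ᵢ X) (x : X) :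
    dist x ((g * h) x) ≤ dist x (g x) + dist x (h x) := by
  have := dist_triangle x (g x) ((g * h) x)
  rwa [IsometryEquiv.mul_apply, g.isometry.dist_eq] at this

lemma jointDispAt_mul_le {S T : Set (X ≃ᵢ X)} (hS : S.Finite) (hT : T.Finite)
    (hS' : S.Nonempty) (hT' : T.Nonempty) (x : X) :
    jointDispAt (S * T) x ≤ jointDispAt S x + jointDispAt T x := by
  refine jointDispAt_le (hS'.mul hT') ?_
  rintro _ ⟨g, hg, h, hh, rfl⟩
  exact (dist_mul_apply_le g h x).trans
    (add_le_add (dist_le_jointDispAt hS x hg) (dist_le_jointDispAt hT x hh))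

lemma jointDispAt_pow_le {S : Set (X ≃ᵢ X)} (hfin : S.Finite) (hne : S.Nonempty) (x : X)
    (n : ℕ) : jointDispAt (S ^ n) x ≤ n * jointDispAt S x := by
  induction n with
  | zero => simp [jointDispAt]
  | succ n ih =>
    rw [pow_succ]
    refine (jointDispAt_mul_le (finite_pow hfin n) hfin hne.pow hne x).trans ?_
    push_cast
    linarith

lemma jointDispAt_pow_le_half_sq {S : Set (X ≃ᵢ X)} (hfin : S.Finite) (hne : S.Nonempty)
    (x : X) (n : ℕ) :
    jointDispAt (S ^ n) x ≤ n * (jointDispAt (S ^ 2) x / 2) + jointDispAt S x := by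
  have hS := jointDispAt_nonneg S x
  have hS2 := jointDispAt_nonneg (S ^ 2) x
  obtain ⟨k, rfl | rfl⟩ := Nat.even_or_odd' n
  · rw [pow_mul]
    refine (jointDispAt_pow_le (finite_pow hfin 2) hne.pow x k).trans ?_
    push_cast
    linarith
  · rw [pow_succ, pow_mul]
    refine (jointDispAt_mul_le (finite_pow (finite_pow hfin 2) k) hfin hne.pow.pow hne x).trans ?_
    have := jointDispAt_pow_le (finite_pow hfin 2) hne.pow x k
    push_cast
    linarith

lemma isBoundedUnder_jointMinDisp_pow_div {S : Set (X ≃ᵢ X)} (hfin : S.Finite)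
    (hne : S.Nonempty) (x : X) :
    IsBoundedUnder (· ≤ ·) atTop fun n : ℕ => jointMinDisp (S ^ n) / n := by
  refine isBoundedUnder_of ⟨jointDispAt S x, fun n => ?_⟩
  refine div_le_of_le_mul₀ n.cast_nonneg (jointDispAt_nonneg S x) ?_
  rw [mul_comm]
  exact (jointMinDisp_le_jointDispAt _ x).trans (jointDispAt_pow_le hfin hne x n)

lemma isBoundedUnder_ge_jointMinDisp_pow_div (S : Set (X ≃ᵢ X)) :
    IsBoundedUnder (· ≥ ·) atTop fun n : ℕ => jointMinDisp (S ^ n) / n :=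
  isBoundedUnder_of ⟨0, fun n => div_nonneg (jointMinDisp_nonneg _) n.cast_nonneg⟩

lemma asympDisp_le_half_jointDispAt_sq {S : Set (X ≃ᵢ X)} (hfin : S.Finite)
    (hne : S.Nonempty) (x : X) : asympDisp S ≤ jointDispAt (S ^ 2) x / 2 := by
  have hlim : Tendsto (fun n : ℕ => jointDispAt (S ^ 2) x / 2 + jointDispAt S x / n) atTop
      (nhds (jointDispAt (S ^ 2) x / 2)) := by
    simpa using (tendsto_const_div_atTop_nhds_zero_nat (jointDispAt S x)).const_add
      (jointDispAt (S ^ 2) x / 2)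
  rw [← hlim.limsup_eq]
  refine limsup_le_limsup ?_ (isBoundedUnder_ge_jointMinDisp_pow_div S).isCoboundedUnder_le
    hlim.isBoundedUnder_le
  filter_upwards [eventually_gt_atTop 0] with n hn
  have hn' : (0 : ℝ) < n := by exact_mod_cast hn
  rw [div_le_iff₀ hn', add_mul, div_mul_cancel₀ _ hn'.ne', mul_comm]
  exact (jointMinDisp_le_jointDispAt _ x).trans (jointDispAt_pow_le_half_sq hfin hne x n)

lemma IsGeodesicSegment.dist_add_dist {s : Set X} {a b x : X} (h : IsGeodesicSegment s a b)
    (hx : x ∈ s) : dist a x + dist x b = dist a b := by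
  obtain ⟨f, h0, h1, hf, rfl⟩ := h
  obtain ⟨u, hu, rfl⟩ := hx
  have hl := hf 0 ⟨le_rfl, dist_nonneg⟩ u hu
  have hr := hf u hu (dist a b) ⟨dist_nonneg, le_rfl⟩
  rw [h0, abs_of_nonpos (by linarith [hu.1])] at hl
  rw [h1, abs_of_nonpos (by linarith [hu.2])] at hr
  linarith

lemma IsGeodesicSegment.exists_midpoint {s : Set X} {a b : X} (h : IsGeodesicSegment s a b) :
    ∃ m ∈ s, dist a m = dist a b / 2 ∧ dist m b = dist a b / 2 := by
  have hs := fun x hx => h.dist_add_dist (x := x) hx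
  obtain ⟨f, h0, h1, hf, rfl⟩ := h
  have hd : 0 ≤ dist a b := dist_nonneg
  have hm : dist a b / 2 ∈ Set.Icc 0 (dist a b) := ⟨by linarith, by linarith⟩
  have hl := hf 0 ⟨le_rfl, hd⟩ _ hm
  rw [h0, abs_of_nonpos (by linarith)] at hl
  have := hs _ (Set.mem_image_of_mem f hm)
  exact ⟨_, Set.mem_image_of_mem f hm, by linarith, by linarith⟩

/-- In a geodesic hyperbolic space, the intersection of two balls of radius `r` whose centres
are at distance `D` lies in a ball of radius `r - D / 2 + 2 * δ`. -/
lemma exists_dist_le_sub_half_dist {δ : ℝ} (hgeo : GeodesicSpace X)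
    (hhyp : GromovHyperbolic X δ) (u v : X) :
    ∃ m, ∀ w r, dist w u ≤ r → dist w v ≤ r → dist w m ≤ r - dist u v / 2 + 2 * δ := by
  obtain ⟨suv, huv⟩ := hgeo u v
  obtain ⟨m, hm, hum, hmv⟩ := huv.exists_midpoint
  refine ⟨m, fun w r hu hv => ?_⟩
  obtain ⟨svw, hvw⟩ := hgeo v w
  obtain ⟨swu, hwu⟩ := hgeo w u
  obtain ⟨q, hq | hq, hmq⟩ := (hhyp u v w suv svw swu huv hvw hwu).1 m hm
  · have h1 := hvw.dist_add_dist hq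
    have h2 := dist_triangle m q v
    have h3 := dist_triangle w q m
    rw [dist_comm v q, dist_comm q w, dist_comm v w] at h1
    rw [dist_comm q m] at h3
    linarith
  · have h1 := hwu.dist_add_dist hq
    have h2 := dist_triangle u q m
    have h3 := dist_triangle w q m
    rw [dist_comm u q] at h2
    rw [dist_comm q m] at h2 h3
    linarith

/-- The circumradius of the orbit `S ^ n • x` grows at least linearly in `n`. -/
lemma mul_half_jointMinDisp_sq_sub_le {δ : ℝ} (hgeo : GeodesicSpace X)
    (hhyp : GromovHyperbolic X δ) {S : Set (X ≃ᵢ X)} (hfin : S.Finite) (hne : S.Nonempty)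
    (hsymm : S = S⁻¹) (x : X) (n : ℕ) (c : X) (r : ℝ) (h : ∀ g ∈ S ^ n, dist (g x) c ≤ r) :
    n * (jointMinDisp (S ^ 2) / 2 - 2 * δ) ≤ r := by
  induction n generalizing c r with
  | zero => simpa using dist_nonneg.trans (h 1 (by simp))
  | succ n ih =>
    obtain ⟨_, hp, hD⟩ := exists_dist_eq_jointDispAt (finite_pow hfin 2) hne.pow c
    rw [pow_two] at hp
    obtain ⟨a, ha, b, hb, rfl⟩ := hp
    have hb' : b⁻¹ ∈ S := by rw [hsymm]; simpa using hb
    have hdist : dist (a⁻¹ c) (b c) = jointDispAt (S ^ 2) c := by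
      rw [← hD, ← a.isometry.dist_eq, IsometryEquiv.apply_inv_self]
      rfl
    obtain ⟨m, hm⟩ := exists_dist_le_sub_half_dist hgeo hhyp (a⁻¹ c) (b c)
    have key : ∀ s ∈ S, ∀ g ∈ S ^ n, dist (g x) (s⁻¹ c) ≤ r := by
      intro s hs g hg
      rw [← s.isometry.dist_eq, IsometryEquiv.apply_inv_self]
      exact h (s * g) (by rw [pow_succ']; exact Set.mul_mem_mul hs hg)
    have := ih m _ fun g hg => hm (g x) r (key a ha g hg) (by simpa using key _ hb' g hg)
    have := jointMinDisp_le_jointDispAt (S ^ 2) c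
    push_cast
    linarith

end JointDisplacement

/-- In a geodesic `δ`-hyperbolic space, for every finite symmetric set `S` of
isometries, `ℓ(S) ≤ L(S²)/2 ≤ ℓ(S) + 2δ`. -/
theorem asympDisp_le_half_jointMinDisp_sq {X : Type*} [MetricSpace X] {δ : ℝ} (hδ : 0 ≤ δ)
    (hgeo : GeodesicSpace X) (hhyp : GromovHyperbolic X δ)
    (S : Set (X ≃ᵢ X)) (hfin : S.Finite) (hne : S.Nonempty) (hsymm : S = S⁻¹) :
    asympDisp S ≤ jointMinDisp (S ^ 2) / 2 ∧
    jointMinDisp (S ^ 2) / 2 ≤ asympDisp S + 2 * δ := by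
  rcases isEmpty_or_nonempty X with hX | ⟨⟨x₀⟩⟩
  · simp [asympDisp, jointMinDisp_of_isEmpty, hδ]
  have : Nonempty X := ⟨x₀⟩
  constructor
  · have : 2 * asympDisp S ≤ jointMinDisp (S ^ 2) := by
      refine le_csInf (Set.range_nonempty _) ?_
      rintro _ ⟨x, rfl⟩
      linarith [asympDisp_le_half_jointDispAt_sq hfin hne x]
    linarith
  · rw [← sub_le_iff_le_add]
    refine le_limsup_of_frequently_le (Eventually.frequently ?_)
      (isBoundedUnder_jointMinDisp_pow_div hfin hne x₀)
    filter_upwards [eventually_gt_atTop 0] with n hn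
    rw [le_div_iff₀ (by exact_mod_cast hn), mul_comm]
    refine le_csInf (Set.range_nonempty _) ?_
    rintro _ ⟨x, rfl⟩
    refine mul_half_jointMinDisp_sq_sub_le hgeo hhyp hfin hne hsymm x n x _ fun g hg => ?_
    rw [dist_comm]
    exact dist_le_jointDispAt (finite_pow hfin n) x hg
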